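/- arXiv:2008.01793 — 2 statements merged into one kernel-verified Lean document; each statement's English description precedes it below -/
import Mathlib

section
/- Let n ≥ 3 be an integer and A an infinite integral domain of finite Krull dimension whose Jacobson radical is trivial. In the group PSL_n(A) := SL_n(A)/Z(SL_n(A)), the center of the centralizer of the image of the elementary matrix e_{1,n} is exactly E_{1,n}(A), the image in PSL_n(A) of the set {e_{1,n}(b) : b ∈ A}. That is, Z(Cent_{PSL_n(A)}(e_{1,n})) = E_{1,n}(A). -/
/-- The elementary matrix `e_{i,j}(a) ∈ SL_n(A)`. -/
def elemSL {n : ℕ} {A : Type*} [CommRing A] (i j : Fin n) (hij : i ≠ j) (a : A) :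
    Matrix.SpecialLinearGroup (Fin n) A :=
  ⟨Matrix.transvection i j a, Matrix.det_transvection_of_ne i j hij a⟩

open Matrix in
/-- Over a domain, two classes in `PSL_n(A)`, one of them that of an elementary matrix `e_{i,j}`,
commute only if the representatives commute. -/
theorem commute_single_of_mk_commute_elemSL {n : ℕ} {A : Type*} [CommRing A] [IsDomain A]
    (G : Matrix.SpecialLinearGroup (Fin n) A) {i j : Fin n} (hij : i ≠ j)
    (h : (QuotientGroup.mk G : Matrix.SpecialLinearGroup (Fin n) A ⧸
        Subgroup.center (Matrix.SpecialLinearGroup (Fin n) A)) *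
          QuotientGroup.mk (elemSL i j hij 1) =
      QuotientGroup.mk (elemSL i j hij 1) * QuotientGroup.mk G) :
    (G : Matrix (Fin n) (Fin n) A) * single i j 1 =
      single i j 1 * (G : Matrix (Fin n) (Fin n) A) := by
  rw [← QuotientGroup.mk_mul, ← QuotientGroup.mk_mul, eq_comm, QuotientGroup.eq,
    Matrix.SpecialLinearGroup.mem_center_iff] at h
  obtain ⟨r, -, hr⟩ := h
  have hG : (G : Matrix (Fin n) (Fin n) A) * transvection i j 1 =
      r • (transvection i j 1 * (G : Matrix (Fin n) (Fin n) A)) := by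
    have h1 : (G * elemSL i j hij 1 : Matrix.SpecialLinearGroup (Fin n) A) =
        (elemSL i j hij 1 * G) * ((elemSL i j hij 1 * G)⁻¹ * (G * elemSL i j hij 1)) := by group
    have h2 := congrArg (fun M : Matrix.SpecialLinearGroup (Fin n) A =>
      (M : Matrix (Fin n) (Fin n) A)) h1
    simp only [Matrix.SpecialLinearGroup.coe_mul _ ((elemSL i j hij 1 * G)⁻¹ * _), ← hr] at h2
    have hT : (elemSL i j hij (1 : A) : Matrix (Fin n) (Fin n) A) = transvection i j 1 := rfl
    simpa [hT, Matrix.SpecialLinearGroup.coe_mul, ← smul_one_eq_diagonal] using h2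
  by_cases hr1 : r = 1
  · simpa [hr1, transvection, mul_add, add_mul] using hG
  · exfalso
    have hent (a b : Fin n) : G a b + (if b = j then G a i else 0) =
        r * (G a b + (if a = i then G j b else 0)) := by
      have := congrFun (congrFun hG a) b
      by_cases hb : b = j <;> by_cases ha : a = i <;>
        simpa [transvection, mul_add, add_mul, hb, ha] using this
    have hzero (a : Fin n) (ha : a ≠ i) : G a i = 0 := by
      have h3 := hent a i
      simp only [hij, ha, if_false, add_zero] at h3
      exact (mul_eq_zero.mp (show (r - 1) * G a i = 0 by linear_combination -h3)).resolve_left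
        (sub_ne_zero.mpr hr1)
    have hcol (a : Fin n) : G a i = 0 := by
      by_cases ha : a = i
      · have h3 := hent i i
        simp only [hij, if_true, if_false, add_zero, hzero j hij.symm] at h3
        rw [ha]
        exact (mul_eq_zero.mp (show (r - 1) * G i i = 0 by linear_combination -h3)).resolve_left
          (sub_ne_zero.mpr hr1)
      · exact hzero a ha
    exact one_ne_zero (G.det_coe.symm.trans (det_eq_zero_of_column_eq_zero i hcol))

open Matrix in
/-- A special linear matrix of the form `c • e_{i,j}(b)` has the same class in `PSL_n(A)` as an
elementary matrix. -/
theorem exists_mk_eq_mk_elemSL {n : ℕ} {A : Type*} [CommRing A]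
    (G : Matrix.SpecialLinearGroup (Fin n) A) {i j : Fin n} (hij : i ≠ j)
    (hdiag : ∀ a, G a a = G j j) (hoff : ∀ a b, a ≠ b → ¬(a = i ∧ b = j) → G a b = 0) :
    ∃ b : A, (QuotientGroup.mk G : Matrix.SpecialLinearGroup (Fin n) A ⧸
        Subgroup.center (Matrix.SpecialLinearGroup (Fin n) A)) =
          QuotientGroup.mk (elemSL i j hij b) := by
  obtain ⟨d, hd⟩ : ∃ d, d * G j j = 1 := by
    refine ⟨(G⁻¹ : Matrix.SpecialLinearGroup (Fin n) A) j j, ?_⟩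
    have h1 : ((G * G⁻¹ : Matrix.SpecialLinearGroup (Fin n) A) : Matrix (Fin n) (Fin n) A) j j =
        1 := by
      rw [mul_inv_cancel]; simp
    rw [Matrix.SpecialLinearGroup.coe_mul, mul_apply, Finset.sum_eq_single j, mul_comm] at h1
    · exact h1
    · intro b _ hb
      rw [hoff j b hb.symm (fun h => hij h.1.symm), zero_mul]
    · simp
  refine ⟨d * G i j, ?_⟩
  have hT : (elemSL i j hij (d * G i j) : Matrix (Fin n) (Fin n) A) =
      d • (G : Matrix (Fin n) (Fin n) A) := by
    ext a b
    change transvection i j (d * G i j) a b = d * G a b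
    by_cases hab : a = b
    · subst hab
      have : ¬(i = a ∧ j = a) := fun h => hij (h.1.trans h.2.symm)
      simp [transvection, this, hdiag a, hd]
    · by_cases h : a = i ∧ b = j
      · simp [transvection, h.1, h.2, hij]
      · have : ¬(i = a ∧ j = b) := fun h' => h ⟨h'.1.symm, h'.2.symm⟩
        simp [transvection, this, hab, hoff a b hab h]
  have hC : ((G⁻¹ * elemSL i j hij (d * G i j) : Matrix.SpecialLinearGroup (Fin n) A) :
      Matrix (Fin n) (Fin n) A) = d • 1 := by
    rw [Matrix.SpecialLinearGroup.coe_mul, hT, mul_smul_comm, ← Matrix.SpecialLinearGroup.coe_mul,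
      inv_mul_cancel, Matrix.SpecialLinearGroup.coe_one]
  rw [QuotientGroup.eq, Subgroup.mem_center_iff]
  intro H
  apply Subtype.ext
  change (H : Matrix (Fin n) (Fin n) A) * _ = _ * (H : Matrix (Fin n) (Fin n) A)
  rw [hC]
  simp

open Matrix in
/-- If `M` commutes with the matrix unit `E_{i,j}`, then the `i`-th column and the `j`-th row of
`M` vanish off the diagonal and the `i`-th and `j`-th diagonal entries agree. -/
theorem entries_of_mul_single_eq {n : ℕ} {A : Type*} [CommRing A]
    {M : Matrix (Fin n) (Fin n) A} {i j : Fin n}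
    (h : M * single i j 1 = single i j 1 * M) :
    (∀ a, a ≠ i → M a i = 0) ∧ (∀ b, b ≠ j → M j b = 0) ∧ M i i = M j j := by
  refine ⟨fun a ha => ?_, fun b hb => ?_, ?_⟩
  · simpa [ha] using congrFun (congrFun h a) j
  · simpa [hb] using (congrFun (congrFun h i) b).symm
  · simpa using congrFun (congrFun h i) j

open Matrix in
theorem mk_elemSL_commute_of_mk_commute {n : ℕ} {A : Type*} [CommRing A] [IsDomain A]
    (G : Matrix.SpecialLinearGroup (Fin n) A) {i j : Fin n} (hij : i ≠ j)
    (h : (QuotientGroup.mk G : Matrix.SpecialLinearGroup (Fin n) A ⧸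
        Subgroup.center (Matrix.SpecialLinearGroup (Fin n) A)) *
          QuotientGroup.mk (elemSL i j hij 1) =
      QuotientGroup.mk (elemSL i j hij 1) * QuotientGroup.mk G) (b : A) :
    (QuotientGroup.mk (elemSL i j hij b) : Matrix.SpecialLinearGroup (Fin n) A ⧸
        Subgroup.center (Matrix.SpecialLinearGroup (Fin n) A)) * QuotientGroup.mk G =
      QuotientGroup.mk G * QuotientGroup.mk (elemSL i j hij b) := by
  have hE := commute_single_of_mk_commute_elemSL G hij h
  rw [← QuotientGroup.mk_mul, ← QuotientGroup.mk_mul]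
  congr 1
  apply Subtype.ext
  change transvection i j b * (G : Matrix (Fin n) (Fin n) A) =
    (G : Matrix (Fin n) (Fin n) A) * transvection i j b
  have hb : single i j b = b • single i j (1 : A) := by simp
  rw [transvection, hb, add_mul, mul_add, smul_mul_assoc, mul_smul_comm, hE, one_mul, mul_one]

open Matrix in
theorem elemSL_commute {n : ℕ} {A : Type*} [CommRing A] {i j k l : Fin n}
    (hij : i ≠ j) (hkl : k ≠ l) (hjk : j ≠ k) (hli : l ≠ i) (a b : A) :
    elemSL i j hij a * elemSL k l hkl b = elemSL k l hkl b * elemSL i j hij a := by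
  apply Subtype.ext
  change transvection i j a * transvection k l b = transvection k l b * transvection i j a
  simp [transvection, mul_add, add_mul, hjk, hli]
  abel

/-- Lemma A.4(1): in `PSL_n(A) = SL_n(A)/Z(SL_n(A))`, the center of the centralizer of
the image of `e_{1,n}` equals `E_{1,n}(A)`, the image of `{e_{1,n}(b) : b ∈ A}`. -/
theorem center_centralizer_elem_eq (n : ℕ) (hn : 3 ≤ n)
    (A : Type*) [CommRing A] [IsDomain A] [Infinite A]
    (hdim : ringKrullDim A ≠ ⊤)
    (hjac : Ideal.jacobson (⊥ : Ideal A) = ⊥) :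
    {g : Matrix.SpecialLinearGroup (Fin n) A ⧸
        Subgroup.center (Matrix.SpecialLinearGroup (Fin n) A) |
      g ∈ Subgroup.centralizer
          {(QuotientGroup.mk (elemSL (⟨0, by omega⟩ : Fin n) (⟨n - 1, by omega⟩ : Fin n)
            (by simp [Fin.ext_iff]; omega) (1 : A)))} ∧
      ∀ h ∈ Subgroup.centralizer
          {(QuotientGroup.mk (elemSL (⟨0, by omega⟩ : Fin n) (⟨n - 1, by omega⟩ : Fin n)
            (by simp [Fin.ext_iff]; omega) (1 : A)))}, g * h = h * g} =
    {g : Matrix.SpecialLinearGroup (Fin n) A ⧸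
        Subgroup.center (Matrix.SpecialLinearGroup (Fin n) A) |
      ∃ b : A, g = QuotientGroup.mk (elemSL (⟨0, by omega⟩ : Fin n) (⟨n - 1, by omega⟩ : Fin n)
        (by simp [Fin.ext_iff]; omega) b)} := by
  set o : Fin n := ⟨0, by omega⟩ with ho
  set l : Fin n := ⟨n - 1, by omega⟩ with hl
  have hol : o ≠ l := by simp [ho, hl, Fin.ext_iff]; omega
  ext g
  simp only [Set.mem_ofPred_eq, Subgroup.mem_centralizer_singleton_iff]
  constructor
  · rintro ⟨-, hcomm⟩
    obtain ⟨G, rfl⟩ := QuotientGroup.mk_surjective g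
    have key (i j : Fin n) (hij : i ≠ j) (hi : i ≠ l) (hj : j ≠ o) :=
      entries_of_mul_single_eq <| commute_single_of_mk_commute_elemSL G hij <| hcomm _ <| by
        rw [← QuotientGroup.mk_mul, ← QuotientGroup.mk_mul, elemSL_commute hij hol hj hi.symm]
    have avoid (a b : Fin n) : ∃ c, c ≠ a ∧ c ≠ b := by
      obtain ⟨c, hc⟩ := Finset.exists_mem_notMem_of_card_lt_card (s := {a, b})
        (t := Finset.univ) (lt_of_le_of_lt Finset.card_le_two (by simp; omega))
      exact ⟨c, by simpa using hc.2⟩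
    have hdiag (a : Fin n) : G a a = G o o := by
      by_cases ha : a = o
      · rw [ha]
      · exact (key o a (Ne.symm ha) hol ha).2.2.symm
    refine exists_mk_eq_mk_elemSL G hol (fun a => (hdiag a).trans (hdiag l).symm) ?_
    intro a b hab h
    by_cases hb : b = l
    · obtain ⟨c, hca, hcl⟩ := avoid a l
      exact (key c a hca hcl fun ha => h ⟨ha, hb⟩).2.1 b hab.symm
    · obtain ⟨c, hcb, hco⟩ := avoid b o
      exact (key b c hcb.symm hb hco).1 a hab
  · rintro ⟨b, rfl⟩
    refine ⟨?_, fun h hh => ?_⟩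
    · rw [← QuotientGroup.mk_mul, ← QuotientGroup.mk_mul, elemSL_commute hol hol hol.symm hol.symm]
    · obtain ⟨H, rfl⟩ := QuotientGroup.mk_surjective h
      exact mk_elemSL_commute_of_mk_commute H hol hh b
end

section
/- Let K be a number field, S a finite set of finite places of K, and A the ring of S-integers of K (the subring of those x ∈ K with v(x) ≥ 0 for every finite place v ∉ S). Let D ≥ 1 and let α ∈ GL_D(A) be an element of infinite order. Then there exist infinitely many maximal ideals 𝔭 ◁ A such that the order of the image of α in GL_D(A/𝔭) is at least |A/𝔭|^(1/(3[K:ℚ])). -/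
open IsDedekindDomain

/-- If every `F m` is nonzero and at most `C ^ m`, then some arbitrarily large primes `p` divide no
`F m` with `m ^ 3 ≤ p`. -/
theorem exists_prime_forall_not_dvd_of_le_pow (F : ℕ → ℕ) (C : ℕ)
    (hF : ∀ m, 1 ≤ m → F m ≠ 0 ∧ F m ≤ C ^ m) (N : ℕ) :
    ∃ p, p.Prime ∧ N ≤ p ∧ ∀ m, 1 ≤ m → m ^ 3 ≤ p → ¬ p ∣ F m := by
  by_contra! h
  have hC : 1 ≤ C := by
    have := hF 1 le_rfl
    rw [pow_one] at this
    omega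
  have hdvd (Y : ℕ) : primorial (Y ^ 3) ∣ N.factorial * ∏ m ∈ Finset.Icc 1 Y, F m := by
    refine Finset.prod_primes_dvd _ (fun p hp ↦ (Finset.mem_filter.mp hp).2.prime) fun p hp ↦ ?_
    obtain ⟨hpY, hp⟩ := Finset.mem_filter.mp hp
    rcases lt_or_ge p N with hpN | hpN
    · exact dvd_mul_of_dvd_left (Nat.dvd_factorial hp.pos hpN.le) _
    · obtain ⟨m, hm, hmp, hd⟩ := h p hp hpN
      have : m ^ 3 ≤ Y ^ 3 := by
        have := Finset.mem_range.mp hpY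
        omega
      have hmY : m ≤ Y := le_of_pow_le_pow_left₀ (by norm_num) (Nat.zero_le _) this
      exact (hd.trans (Finset.dvd_prod_of_mem F (Finset.mem_Icc.mpr ⟨hm, hmY⟩))).mul_left _
  have hle (Y : ℕ) : primorial (Y ^ 3) ≤ N.factorial * C ^ (Y * Y) := by
    refine (Nat.le_of_dvd ?_ (hdvd Y)).trans (Nat.mul_le_mul_left _ ?_)
    · exact Nat.mul_pos N.factorial_pos (Finset.prod_pos fun m hm ↦
        Nat.pos_of_ne_zero (hF m (Finset.mem_Icc.mp hm).1).1)
    · calc ∏ m ∈ Finset.Icc 1 Y, F m ≤ ∏ m ∈ Finset.Icc 1 Y, C ^ Y :=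
            Finset.prod_le_prod' fun m hm ↦ ((hF m (Finset.mem_Icc.mp hm).1).2.trans
              (Nat.pow_le_pow_right hC (Finset.mem_Icc.mp hm).2))
        _ = C ^ (Y * Y) := by simp [← pow_mul]
  set a : ℝ := Real.log N.factorial
  set b : ℝ := Real.log C
  have ha0 : 0 ≤ a := Real.log_natCast_nonneg _
  have hb0 : 0 ≤ b := Real.log_natCast_nonneg _
  obtain ⟨Z, hZ⟩ := exists_nat_gt (2 * (a + b + 20))
  have hZ1 : (1 : ℝ) ≤ Z := by linarith
  have hZ0 : (0 : ℝ) < Z := by linarith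
  have hupper : Chebyshev.theta ((Z ^ 6 : ℕ) : ℝ) ≤ a + Z ^ 4 * b := by
    rw [Chebyshev.theta_eq_log_primorial, Nat.floor_natCast]
    have h1 := hle (Z ^ 2)
    rw [← pow_mul, ← pow_add] at h1
    have h2 : ((primorial (Z ^ 6) : ℕ) : ℝ) ≤ (N.factorial : ℝ) * (C : ℝ) ^ (Z ^ 4) := by
      exact_mod_cast h1
    have h3 := Real.log_le_log (by exact_mod_cast primorial_pos _) h2
    rwa [Real.log_mul (by positivity) (by positivity), Real.log_pow, Nat.cast_pow] at h3
  have hlower := Chebyshev.theta_ge (Z ^ 6)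
  have hlogZ : Real.log Z ≤ Z := (Real.log_le_sub_one_of_pos hZ0).trans (by linarith)
  have hs : √((Z ^ 6 : ℕ) : ℝ) = Z ^ 3 := by
    rw [Nat.cast_pow, show (Z : ℝ) ^ 6 = (Z ^ 3) ^ 2 by ring, Real.sqrt_sq (by positivity)]
  have hlog6 : Real.log ((Z ^ 6 : ℕ) : ℝ) ≤ 6 * Z := by
    rw [Nat.cast_pow, Real.log_pow]
    push_cast
    linarith
  have hlog7 : Real.log (((Z ^ 6 : ℕ) : ℝ) + 1) ≤ 1 + 6 * Z := by
    have h6 : (1 : ℝ) ≤ ((Z ^ 6 : ℕ) : ℝ) := by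
      rw [Nat.cast_pow]; exact one_le_pow₀ hZ1
    have : Real.log (((Z ^ 6 : ℕ) : ℝ) + 1) ≤ Real.log (2 * ((Z ^ 6 : ℕ) : ℝ)) :=
      Real.log_le_log (by linarith) (by linarith)
    rw [Real.log_mul (by norm_num) (by linarith)] at this
    linarith [Real.log_two_lt_d9]
  have hlog2 := Real.log_two_gt_d9
  rw [hs] at hlower
  have hm1 : (Z : ℝ) ^ 3 * Real.log ((Z ^ 6 : ℕ) : ℝ) ≤ Z ^ 3 * (6 * Z) := by gcongr
  have hm2 : (Z : ℝ) ^ 6 * (1 / 2) ≤ (Z : ℝ) ^ 6 * Real.log 2 := by gcongr; linarith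
  simp only [Nat.cast_pow] at hlower hupper hlog6 hlog7 hm1
  have h4 : (1 : ℝ) ≤ Z ^ 4 := one_le_pow₀ hZ1
  have h41 : (Z : ℝ) ≤ Z ^ 4 := le_self_pow₀ hZ1 (by norm_num)
  have h46 : (Z : ℝ) ^ 4 * (2 * (a + b + 20)) ≤ Z ^ 6 := by
    calc (Z : ℝ) ^ 4 * (2 * (a + b + 20)) ≤ (Z : ℝ) ^ 4 * Z := by gcongr
      _ = (Z : ℝ) ^ 5 := by ring
      _ ≤ (Z : ℝ) ^ 6 := pow_le_pow_right₀ hZ1 (by norm_num)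
  nlinarith [mul_nonneg ha0 (sub_nonneg.mpr h4)]

/-- A finite residue field of characteristic `p` of a subring of a number field `K` has at most
`p ^ [K : ℚ]` elements. -/
theorem card_le_pow_finrank_of_surjective {R K k : Type*} [CommRing R] [Field K] [NumberField K]
    [Field k] [Finite k] (p : ℕ) [Fact p.Prime] [CharP k p] (f : R →+* K)
    (hf : Function.Injective f) (g : R →+* k) (hg : Function.Surjective g) :
    Nat.card k ≤ p ^ Module.finrank ℚ K := by
  let : Algebra (ZMod p) k := ZMod.algebra k p
  let b := Module.finBasis (ZMod p) k
  choose x hx using fun i ↦ hg (b i)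
  have hli : LinearIndependent ℤ (fun i ↦ f (x i)) := by
    rw [Fintype.linearIndependent_iff]
    intro c hc
    by_contra! hne
    obtain ⟨i₀, hi₀⟩ := hne
    obtain ⟨c', hc', hgcd⟩ := Finset.univ.extract_gcd c ⟨i₀, Finset.mem_univ _⟩
    have hd : Finset.univ.gcd c ≠ 0 := fun h0 ↦ hi₀ (by simpa [h0] using hc' i₀)
    have hsum : ∑ i, (c' i : R) * x i = 0 := by
      apply hf
      have hd' : ((Finset.univ.gcd c : ℤ) : K) ≠ 0 := by exact_mod_cast hd
      apply mul_left_cancel₀ hd'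
      rw [map_zero, mul_zero, ← hc, map_sum, Finset.mul_sum]
      refine Finset.sum_congr rfl fun i hi ↦ ?_
      rw [zsmul_eq_mul, hc' i hi]
      simp [mul_assoc]
    have hsum' : ∑ i, (c' i : ZMod p) • b i = 0 := by
      have := congrArg g hsum
      simpa [hx, Algebra.smul_def] using this
    have hz := Fintype.linearIndependent_iff.mp b.linearIndependent _ hsum'
    have hp1 : (p : ℤ) ∣ 1 := by
      rw [← hgcd]
      exact Finset.dvd_gcd fun i _ ↦ (ZMod.intCast_zmod_eq_zero_iff_dvd _ _).mp (hz i)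
    exact (Fact.out : p.Prime).one_lt.ne'
      (by exact_mod_cast Int.eq_one_of_dvd_one (by positivity) hp1)
  have hcard := ((LinearIndependent.iff_fractionRing ℤ ℚ).mp hli).fintype_card_le_finrank
  rw [Fintype.card_fin] at hcard
  rw [Module.natCard_eq_pow_finrank (K := ZMod p), Nat.card_zmod]
  exact Nat.pow_le_pow_right (Fact.out : p.Prime).pos hcard

attribute [local instance] Matrix.linftyOpNormedRing in
/-- The entries of `M ^ m - 1` grow at most exponentially in `m`. -/
theorem Matrix.exists_norm_pow_sub_one_apply_le {n : Type*} [Fintype n] [DecidableEq n]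
    (M : Matrix n n ℂ) : ∃ B : ℝ, 1 ≤ B ∧ ∀ m, 1 ≤ m → ∀ i j, ‖(M ^ m - 1) i j‖ ≤ B ^ m := by
  refine ⟨‖M‖ + (1 + ‖(1 : Matrix n n ℂ)‖),
    by linarith [norm_nonneg M, norm_nonneg (1 : Matrix n n ℂ)], fun m hm i j ↦ ?_⟩
  have hentry (X : Matrix n n ℂ) : ‖X i j‖ ≤ ‖X‖ := by
    rw [Matrix.linfty_opNorm_def, ← coe_nnnorm, NNReal.coe_le_coe]
    exact (Finset.single_le_sum (f := fun j ↦ ‖X i j‖₊) (fun _ _ ↦ zero_le)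
      (Finset.mem_univ j)).trans
      (Finset.le_sup (f := fun i ↦ ∑ j, ‖X i j‖₊) (Finset.mem_univ i))
  calc ‖(M ^ m - 1) i j‖ ≤ ‖M ^ m - 1‖ := hentry _
    _ ≤ ‖M‖ ^ m + (1 + ‖(1 : Matrix n n ℂ)‖) ^ m := by
      have h1 := norm_pow_le' M hm
      have h2 : 1 + ‖(1 : Matrix n n ℂ)‖ ≤ (1 + ‖(1 : Matrix n n ℂ)‖) ^ m :=
        le_self_pow₀ (by simp) (by omega)
      linarith [norm_sub_le (M ^ m) 1]
    _ ≤ _ := pow_add_pow_le (norm_nonneg _) (by positivity) (by omega)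

/-- If no positive power of the matrix `M` over a number field is trivial, then for `m ≥ 1`
some entry of `M ^ m - 1`, multiplied by `b ^ m` for a fixed integer `b`, is a nonzero algebraic
integer of norm at most `C ^ m`. -/
theorem NumberField.exists_integer_entry_pow_sub_one {K n : Type*} [Field K] [NumberField K]
    [Fintype n] [DecidableEq n] (M : Matrix n n K) (hM : ∀ m, 1 ≤ m → M ^ m ≠ 1) :
    ∃ (b : ℤ) (C : ℕ), ∀ m, 1 ≤ m → ∃ (i j : n) (y : RingOfIntegers K),
      (y : K) = (b : K) ^ m * (M ^ m - 1) i j ∧ y ≠ 0 ∧ (Algebra.norm ℤ y).natAbs ≤ C ^ m := by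
  classical
  obtain ⟨b, hb0, hb⟩ := exists_integral_multiples ℤ ℚ
    (Finset.univ.image fun ij : n × n ↦ M ij.1 ij.2)
  have hb' (i j) : IsIntegral ℤ ((b : K) * M i j) := by
    rw [← zsmul_eq_mul]
    exact hb _ (Finset.mem_image.mpr ⟨(i, j), Finset.mem_univ _, rfl⟩)
  choose z hz using fun i j ↦ (⟨⟨_, hb' i j⟩, rfl⟩ : ∃ z : RingOfIntegers K, (z : K) = b * M i j)
  choose B hB1 hB using fun σ : K →ₐ[ℚ] ℂ ↦
    (M.map σ).exists_norm_pow_sub_one_apply_le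
  obtain ⟨C, hC⟩ := exists_nat_ge (∏ σ : K →ₐ[ℚ] ℂ, |(b : ℝ)| * B σ)
  refine ⟨b, C, fun m hm ↦ ?_⟩
  obtain ⟨i, j, hij⟩ : ∃ i j, (M ^ m - 1) i j ≠ 0 := by
    by_contra! h
    exact hM m hm (sub_eq_zero.mp (Matrix.ext h))
  have hzM : (Matrix.of z).map (algebraMap (RingOfIntegers K) K) = (b : K) • M := by
    ext i j
    simp [hz]
  let y : RingOfIntegers K :=
    (Matrix.of z ^ m - (b : RingOfIntegers K) ^ m • (1 : Matrix n n (RingOfIntegers K))) i j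
  have hy : (y : K) = (b : K) ^ m * (M ^ m - 1) i j := by
    have h1 : ((Matrix.of z ^ m - (b : RingOfIntegers K) ^ m • (1 : Matrix n n (RingOfIntegers K))).map
        (algebraMap (RingOfIntegers K) K)) = (b : K) ^ m • (M ^ m - 1) := by
      rw [Matrix.map_sub _ (map_sub _), Matrix.map_pow, hzM, smul_pow, smul_sub]
      congr 1
      ext i j
      by_cases h : i = j <;> simp [h]
    exact congrFun (congrFun h1 i) j
  refine ⟨i, j, y, hy, fun h0 ↦ ?_, ?_⟩
  · rw [h0] at hy
    have hbK : (b : K) ^ m ≠ 0 := pow_ne_zero _ (by exact_mod_cast hb0)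
    exact mul_ne_zero hbK hij (by simpa using hy.symm)
  · have hnorm : ((Algebra.norm ℤ y).natAbs : ℝ) = ∏ σ : K →ₐ[ℚ] ℂ, ‖σ (y : K)‖ := by
      have h1 := Algebra.norm_eq_prod_embeddings ℚ ℂ (y : K)
      rw [← norm_prod, ← h1, ← Algebra.coe_norm_int]
      simp [Nat.cast_natAbs]
    rw [← Nat.cast_le (α := ℝ), hnorm, Nat.cast_pow]
    refine le_trans ?_ (pow_le_pow_left₀ (Finset.prod_nonneg fun σ _ ↦
      mul_nonneg (abs_nonneg _) (by linarith [hB1 σ])) hC m)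
    rw [← Finset.prod_pow]
    refine Finset.prod_le_prod (fun _ _ ↦ norm_nonneg _) fun σ _ ↦ ?_
    have hσ : σ ((M ^ m - 1) i j) = ((M.map σ) ^ m - 1) i j := by
      have : (M ^ m - 1).map σ = (M.map σ) ^ m - 1 := by
        change σ.mapMatrix (M ^ m - 1) = σ.mapMatrix M ^ m - 1
        rw [map_sub, map_pow, map_one]
      exact congrFun (congrFun this i) j
    rw [hy, map_mul, hσ, norm_mul, mul_pow, map_pow, norm_pow, map_intCast, Complex.norm_intCast]
    exact mul_le_mul_of_nonneg_left (hB σ m hm i j) (by positivity)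

theorem natCast_mem_ideal_iff_dvd {R : Type*} [CommRing R] {I : Ideal R} (hI : I ≠ ⊤) {p : ℕ}
    (hp : p.Prime) (hpI : (p : R) ∈ I) (n : ℕ) : (n : R) ∈ I ↔ p ∣ n := by
  refine ⟨fun hn ↦ ?_, fun ⟨c, hc⟩ ↦ by rw [hc, Nat.cast_mul]; exact I.mul_mem_right _ hpI⟩
  by_contra hd
  refine hI ((Ideal.eq_top_iff_one I).mpr ?_)
  obtain ⟨a, b, hab⟩ := Nat.isCoprime_iff_coprime.mpr ((hp.coprime_iff_not_dvd).mpr hd)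
  have h := congrArg (Int.cast : ℤ → R) hab
  push_cast at h
  rw [← h]
  exact I.add_mem (I.mul_mem_left _ hpI) (I.mul_mem_left _ hn)

theorem eq_of_prime_of_natCast_mem {R : Type*} [CommRing R] {I : Ideal R} (hI : I ≠ ⊤) {p q : ℕ}
    (hp : p.Prime) (hq : q.Prime) (hpI : (p : R) ∈ I) (hqI : (q : R) ∈ I) : p = q :=
  (Nat.prime_dvd_prime_iff_eq hp hq).mp ((natCast_mem_ideal_iff_dvd hI hp hpI q).mp hqI)

/-- All but finitely many primes `p` are non-units in the ring of `S`-integers, for finite `S`. -/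
theorem Set.integer.exists_forall_prime_not_isUnit (K : Type*) [Field K] [NumberField K]
    (S : Set (HeightOneSpectrum (NumberField.RingOfIntegers K))) (hS : S.Finite) :
    ∃ N : ℕ, ∀ p : ℕ, p.Prime → N ≤ p → ¬ IsUnit (p : S.integer K) := by
  have hfin : {p : ℕ | p.Prime ∧ ∃ v ∈ S, (p : NumberField.RingOfIntegers K) ∈ v.asIdeal}.Finite := by
    refine (hS.biUnion (t := fun v ↦ {p : ℕ | p.Prime ∧
      (p : NumberField.RingOfIntegers K) ∈ v.asIdeal}) fun v _ ↦
        Set.Subsingleton.finite fun p hp q hq ↦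
          eq_of_prime_of_natCast_mem v.isPrime.ne_top hp.1 hq.1 hp.2 hq.2).subset ?_
    rintro p ⟨hp, v, hv, hpv⟩
    exact Set.mem_biUnion hv ⟨hp, hpv⟩
  obtain ⟨N, hN⟩ := hfin.bddAbove
  refine ⟨N + 1, fun p hp hpN hu ↦ ?_⟩
  have hpu : ¬ IsUnit (p : NumberField.RingOfIntegers K) := by
    intro h
    have h1 : IsUnit (algebraMap ℤ (NumberField.RingOfIntegers K) p) := by simpa using h
    exact (Nat.prime_iff_prime_int.mp hp).not_isUnit ((isUnit_map_iff _ _).mp h1)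
  obtain ⟨P, hP, hpP⟩ := exists_max_ideal_of_mem_nonunits hpu
  let v : HeightOneSpectrum (NumberField.RingOfIntegers K) := ⟨P, hP.isPrime, fun h ↦ by
    rw [h, Ideal.mem_bot] at hpP
    exact hp.ne_zero (by exact_mod_cast hpP)⟩
  have hv : v ∉ S := fun hvS ↦ by
    have : p ≤ N := hN ⟨hp, v, hvS, hpP⟩
    omega
  obtain ⟨u, hu⟩ := hu.exists_right_inv
  have h1 : v.valuation K (p : K) < 1 := by
    have := (v.valuation_lt_one_iff_mem (K := K) (p : NumberField.RingOfIntegers K)).mpr hpP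
    simpa using this
  have h2 := S.integer_valuation_le_one K u hv
  have h3 : (p : K) * (u : K) = 1 := by exact_mod_cast congrArg Subtype.val hu
  have h4 := congrArg (v.valuation K) h3
  rw [map_mul, map_one] at h4
  exact (mul_lt_one_of_lt_of_le h1 h2).ne h4


open IsDedekindDomain

/-- Lemma 6.4: if `α ∈ GL_D(A)` has infinite order, where `A` is a ring of `S`-integers of a
number field `K`, then there are infinitely many maximal ideals `𝔭 ◁ A` such that the order of
the image of `α` in `GL_D(A/𝔭)` is at least `|A/𝔭|^(1/(3[K:ℚ]))`. -/
theorem infinitely_many_primes_large_order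
    (K : Type*) [Field K] [NumberField K]
    (S : Set (HeightOneSpectrum (NumberField.RingOfIntegers K))) (hS : S.Finite)
    (D : ℕ) (hD : 1 ≤ D)
    (α : GL (Fin D) (S.integer K)) (hα : ¬ IsOfFinOrder α) :
    {𝔭 : Ideal (S.integer K) | 𝔭.IsMaximal ∧
      ((Nat.card ((S.integer K) ⧸ 𝔭) : ℝ) ^
          ((1 : ℝ) / (3 * (Module.finrank ℚ K : ℝ))) ≤
        (orderOf (Matrix.GeneralLinearGroup.map (Ideal.Quotient.mk 𝔭) α) : ℝ))}.Infinite := by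
  obtain ⟨N₀, hN₀⟩ := Set.integer.exists_forall_prime_not_isUnit K S hS
  have hinj : Function.Injective (algebraMap (S.integer K) K) := Subtype.val_injective
  let M : Matrix (Fin D) (Fin D) K := (algebraMap (S.integer K) K).mapMatrix α.val
  have hMpow (m : ℕ) : M ^ m = (algebraMap (S.integer K) K).mapMatrix (α.val ^ m) :=
    (map_pow _ _ _).symm
  have hM (m : ℕ) (hm : 1 ≤ m) : M ^ m ≠ 1 := by
    intro h
    refine hα (isOfFinOrder_iff_pow_eq_one.mpr ⟨m, hm, Units.ext ?_⟩)
    refine Matrix.map_injective hinj ?_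
    rw [hMpow, ← map_one (algebraMap (S.integer K) K).mapMatrix] at h
    simpa using h
  obtain ⟨b, C, hbC⟩ := NumberField.exists_integer_entry_pow_sub_one M hM
  have : Nonempty (Fin D) := ⟨⟨0, hD⟩⟩
  choose! i j y hy hy0 hyC using hbC
  intro hfin
  have hfin' : {p : ℕ | p.Prime ∧ ∃ 𝔭 : Ideal (S.integer K), (𝔭.IsMaximal ∧
      ((Nat.card ((S.integer K) ⧸ 𝔭) : ℝ) ^
          ((1 : ℝ) / (3 * (Module.finrank ℚ K : ℝ))) ≤
        (orderOf (Matrix.GeneralLinearGroup.map (Ideal.Quotient.mk 𝔭) α) : ℝ))) ∧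
      (p : S.integer K) ∈ 𝔭}.Finite := by
    refine (hfin.biUnion (t := fun 𝔭 ↦ {p : ℕ | 𝔭 ≠ ⊤ ∧ p.Prime ∧ (p : S.integer K) ∈ 𝔭})
      fun 𝔭 _ ↦ Set.Subsingleton.finite fun p hp q hq ↦
        eq_of_prime_of_natCast_mem hp.1 hp.2.1 hq.2.1 hp.2.2 hq.2.2).subset ?_
    rintro p ⟨hp, 𝔭, h𝔭, hp𝔭⟩
    exact Set.mem_biUnion (Set.mem_ofPred.mpr h𝔭) ⟨h𝔭.1.ne_top, hp, hp𝔭⟩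
  obtain ⟨N₁, hN₁⟩ := hfin'.bddAbove
  obtain ⟨p, hp, hpN, hpd⟩ := exists_prime_forall_not_dvd_of_le_pow
    (fun m ↦ (Algebra.norm ℤ (y m)).natAbs) C
    (fun m hm ↦ ⟨by simpa [Algebra.norm_eq_zero_iff] using hy0 m hm, hyC m hm⟩) (N₀ + N₁ + 1)
  obtain ⟨𝔭, h𝔭, hp𝔭⟩ := exists_max_ideal_of_mem_nonunits (hN₀ p hp (by omega))
  have hbad : (orderOf (Matrix.GeneralLinearGroup.map (Ideal.Quotient.mk 𝔭) α) : ℝ) <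
      (Nat.card ((S.integer K) ⧸ 𝔭) : ℝ) ^ ((1 : ℝ) / (3 * (Module.finrank ℚ K : ℝ))) := by
    by_contra! hle
    have : p ≤ N₁ := hN₁ ⟨hp, 𝔭, ⟨h𝔭, hle⟩, hp𝔭⟩
    omega
  set β := Matrix.GeneralLinearGroup.map (n := Fin D) (Ideal.Quotient.mk 𝔭) α
  have hd : 0 < Module.finrank ℚ K := Module.finrank_pos
  have hcard : Nat.card ((S.integer K) ⧸ 𝔭) ≠ 0 := by
    intro h0
    rw [h0, Nat.cast_zero, Real.zero_rpow (by positivity)] at hbad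
    exact absurd hbad (not_lt.mpr (Nat.cast_nonneg _))
  have : Finite ((S.integer K) ⧸ 𝔭) := Nat.finite_of_card_ne_zero hcard
  have : Fact p.Prime := ⟨hp⟩
  let : Field ((S.integer K) ⧸ 𝔭) := Ideal.Quotient.field 𝔭
  have : CharP ((S.integer K) ⧸ 𝔭) p := ⟨fun n ↦ by
    rw [← natCast_mem_ideal_iff_dvd h𝔭.ne_top hp hp𝔭, ← Ideal.Quotient.eq_zero_iff_mem,
      map_natCast]⟩
  have hcardle := card_le_pow_finrank_of_surjective p (algebraMap (S.integer K) K) hinj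
    (Ideal.Quotient.mk 𝔭) Ideal.Quotient.mk_surjective
  have hm : 1 ≤ orderOf β := orderOf_pos β
  refine hpd (orderOf β) hm ?_ ?_
  · have h1 : (orderOf β : ℝ) < (p : ℝ) ^ ((1 : ℝ) / 3) := by
      refine hbad.trans_le ?_
      calc (Nat.card ((S.integer K) ⧸ 𝔭) : ℝ) ^ ((1 : ℝ) / (3 * (Module.finrank ℚ K : ℝ)))
          ≤ ((p : ℝ) ^ Module.finrank ℚ K) ^ ((1 : ℝ) / (3 * (Module.finrank ℚ K : ℝ))) := by
            gcongr
            exact_mod_cast hcardle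
        _ = (p : ℝ) ^ ((1 : ℝ) / 3) := by
            rw [← Real.rpow_natCast, ← Real.rpow_mul (Nat.cast_nonneg p)]
            congr 1
            field_simp
    have h2 : (orderOf β : ℝ) ^ 3 ≤ ((p : ℝ) ^ ((1 : ℝ) / 3)) ^ 3 := by gcongr
    rw [← Real.rpow_natCast ((p : ℝ) ^ ((1 : ℝ) / 3)), ← Real.rpow_mul (Nat.cast_nonneg p)] at h2
    norm_num at h2
    exact_mod_cast h2
  · have hone : ((α.val ^ orderOf β) - 1) (i (orderOf β)) (j (orderOf β)) ∈ 𝔭 := by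
      rw [← Ideal.Quotient.eq_zero_iff_mem]
      have h1 := congrArg Units.val (pow_orderOf_eq_one β)
      have h2 : (Ideal.Quotient.mk 𝔭).mapMatrix (α.val ^ orderOf β - 1) = 0 := by
        rw [map_sub, map_one, map_pow, sub_eq_zero]
        exact h1
      exact congrFun (congrFun h2 _) _
    generalize orderOf β = m at *
    have hymem : algebraMap (NumberField.RingOfIntegers K) (S.integer K) (y m) ∈ 𝔭 := by
      have : algebraMap (NumberField.RingOfIntegers K) (S.integer K) (y m) =
          (b : S.integer K) ^ m * (α.val ^ m - 1) (i m) (j m) := by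
        apply hinj
        rw [← IsScalarTower.algebraMap_apply]
        refine (hy m hm).trans ?_
        rw [map_mul, map_pow, map_intCast]
        congr 1
        rw [hMpow, ← map_one (algebraMap (S.integer K) K).mapMatrix, ← map_sub]
        rfl
      rw [this]
      exact 𝔭.mul_mem_left _ hone
    rw [← natCast_mem_ideal_iff_dvd h𝔭.ne_top hp hp𝔭, ← Ideal.absNorm_span_singleton]
    have h1 := Ideal.absNorm_mem (Ideal.span {y m})
    obtain ⟨c, hc⟩ := Ideal.mem_span_singleton.mp h1
    have h2 := congrArg (algebraMap (NumberField.RingOfIntegers K) (S.integer K)) hc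
    rw [map_natCast, map_mul] at h2
    rw [h2]
    exact 𝔭.mul_mem_right _ hymem
end
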